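/- Fix real numbers a, b, c with b > c > a > 0 and natural numbers n ≥ 1, τ with τ ≤ n - 1. Define, for each t ∈ {1,…,n}, the deviation payoff v_t = (t-1)·c + min(τ+1, n-t+1)·b + max(n-t-τ, 0)·a (all natural-number quantities cast to ℝ). Then the no-profitable-deviation condition (1/n)·∑_{t=1}^{n} v_t ≤ n·c holds if and only if b ≤ c + (c-a)·((n-τ)·(n-τ-1))/((2n-τ)·(τ+1)). -/

import Mathlib

lemma aux_lin (m : ℕ) : ∑ j ∈ Finset.range m, ((j : ℝ) + 1) = m * (m + 1) / 2 := by
  induction m with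
  | zero => simp
  | succ m ih => rw [Finset.sum_range_succ, ih]; push_cast; ring

lemma aux_min (τ k : ℕ) : ∑ j ∈ Finset.range (τ + 1 + k), min ((τ : ℝ) + 1) ((j : ℝ) + 1)
    = (τ + 1) * (τ + 2) / 2 + k * (τ + 1) := by
  induction k with
  | zero =>
    have : ∑ j ∈ Finset.range (τ + 1 + 0), min ((τ : ℝ) + 1) ((j : ℝ) + 1)
        = ∑ j ∈ Finset.range (τ + 1), ((j : ℝ) + 1) := by
      refine Finset.sum_congr rfl fun j hj => min_eq_right ?_
      have : j ≤ τ := by simpa [Nat.lt_succ_iff] using hj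
      have : (j : ℝ) ≤ τ := by exact_mod_cast this
      linarith
    rw [this, aux_lin]; push_cast; ring
  | succ k ih =>
    rw [← add_assoc, Finset.sum_range_succ, ih, min_eq_left]
    · push_cast; ring
    · push_cast
      have : (0 : ℝ) ≤ k := Nat.cast_nonneg k
      linarith


/-- Main theorem (EC_τ): with `b > c > a > 0`, `1 ≤ n`, `τ ≤ n - 1`, and deviation payoffs
`v_t = (t-1)·c + min(τ+1, n-t+1)·b + max(n-t-τ, 0)·a`, the no-profitable-deviation
condition `(1/n)·∑ v_t ≤ n·c` holds iff
`b ≤ c + (c-a)·((n-τ)·(n-τ-1))/((2n-τ)·(τ+1))`. -/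
theorem cooperation_iff_EC (a b c : ℝ) (hba : b > c) (hca : c > a) (ha : a > 0)
    (n τ : ℕ) (hn : 1 ≤ n) (hτ : τ ≤ n - 1) :
    (1 / (n : ℝ)) * ∑ t ∈ Finset.Icc 1 n,
        (((t : ℝ) - 1) * c
          + min ((τ : ℝ) + 1) ((n : ℝ) - (t : ℝ) + 1) * b
          + max ((n : ℝ) - (t : ℝ) - (τ : ℝ)) 0 * a) ≤ (n : ℝ) * c
      ↔ b ≤ c + (c - a) * (((n : ℝ) - τ) * ((n : ℝ) - τ - 1))
              / ((2 * (n : ℝ) - τ) * ((τ : ℝ) + 1)) := by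
  obtain ⟨k, rfl⟩ : ∃ k, n = τ + 1 + k := ⟨n - (τ + 1), by omega⟩
  have hsum : ∑ t ∈ Finset.Icc 1 (τ + 1 + k),
        (((t : ℝ) - 1) * c
          + min ((τ : ℝ) + 1) (((τ + 1 + k : ℕ) : ℝ) - (t : ℝ) + 1) * b
          + max (((τ + 1 + k : ℕ) : ℝ) - (t : ℝ) - (τ : ℝ)) 0 * a)
      = ∑ j ∈ Finset.range (τ + 1 + k),
        (((τ + 1 + k : ℕ) : ℝ) * c + ((j : ℝ) + 1) * (a - c)
          + min ((τ : ℝ) + 1) ((j : ℝ) + 1) * (b - a)) := by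
    refine Finset.sum_nbij' (fun t => τ + 1 + k - t) (fun j => τ + 1 + k - j) ?_ ?_ ?_ ?_ ?_
    · intro t ht; simp only [Finset.mem_Icc, Finset.mem_range] at *; omega
    · intro t ht; simp only [Finset.mem_Icc, Finset.mem_range] at *; omega
    · intro t ht; simp only [Finset.mem_Icc] at *; omega
    · intro t ht; simp only [Finset.mem_range] at *; omega
    · intro t ht
      simp only [Finset.mem_Icc] at ht
      rw [Nat.cast_sub ht.2]
      generalize ((τ + 1 + k : ℕ) : ℝ) = N
      rcases le_total ((τ : ℝ) + 1) (N - t + 1) with h | h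
      · rw [min_eq_left h, max_eq_left (by linarith)]; ring
      · rw [min_eq_right h, max_eq_right (by linarith)]; ring
  rw [hsum, Finset.sum_add_distrib, Finset.sum_add_distrib, ← Finset.sum_mul, ← Finset.sum_mul, ← Finset.sum_mul,
    aux_lin, aux_min, Finset.sum_const, Finset.card_range, nsmul_eq_mul]
  push_cast
  have hk : (0 : ℝ) ≤ k := Nat.cast_nonneg k
  have ht : (0 : ℝ) ≤ τ := Nat.cast_nonneg τ
  generalize (k : ℝ) = x at *
  generalize (τ : ℝ) = y at *
  have hB : 0 < (2 * (y + 1 + x) - y) * (y + 1) := by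
    apply mul_pos <;> linarith
  rw [← sub_le_iff_le_add', le_div_iff₀ hB, one_div, inv_mul_le_iff₀ (by linarith)]
  constructor <;> intro h <;> nlinarith
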